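/- arXiv:1504.01719 — 2 statements merged into one kernel-verified Lean document; each statement's English description precedes it below -/
import Mathlib

section
/- For a nonempty parking function a ∈ P_n with unique factorization a = a^(1) ∘ ⋯ ∘ a^(k) into unsplitable parking functions, set R_a = M_{a^(1)} ⋆ M_{a^(2)} ⋆ ⋯ ⋆ M_{a^(k)}. Then R_a = M_a + Σ_{b ∈ P_n, a ≺*_lex b} c_b M_b for some nonnegative integer coefficients c_b; i.e., R_a equals M_a plus a nonnegative integer combination of basis elements M_b with b strictly greater than a in the total order ≺*_lex. -/
open scoped Classical

/-- Words on natural numbers (letters are intended to be positive integers). -/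
abbrev W : Type := List ℕ

/-- `IsPF a` : the word `a` is a parking function, i.e. all its letters are
positive and its nondecreasing rearrangement `b₁ b₂ ⋯ bₙ` satisfies `bᵢ ≤ i`. -/
def IsPF (a : W) : Prop :=
  (∀ x ∈ a, 1 ≤ x) ∧
    ∀ i, i < a.length → (a.insertionSort (· ≤ ·)).getD i 0 ≤ i + 1

/-- Split a word into the consecutive segments beginning at its
left-to-right minima (in the order in which they occur in the word). -/
def segs : W → List W
  | [] => []
  | x :: xs =>
      (x :: xs.takeWhile fun y => x ≤ y) :: segs (xs.dropWhile fun y => x ≤ y)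
termination_by a => a.length
decreasing_by
  simpa using Nat.lt_succ_of_le (List.dropWhile_sublist _).length_le

/-- The LR-decomposition `F_a` of a word `a`: the sequence of segments beginning
at the left-to-right minima, listed in increasing order of their minimal letters
(i.e. in reverse order of occurrence in `a`). -/
def LR (a : W) : List W := (segs a).reverse

/-- The word `w_k ⋯ w_2 w_1` encoded by an LR-decomposition `(w_1, …, w_k)`. -/
def wordOf (F : List W) : W := F.reverse.flatten

/-- A word is dominated if it is nonempty and its first letter is its minimal letter. -/
def Dominated (w : W) : Prop := w ≠ [] ∧ ∀ x ∈ w, w.headD 0 ≤ x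

/-- The minimal letter of a word (`0` for the empty word). -/
def minW (w : W) : ℕ := (w.min?).getD 0

/-- Add `m` to every letter of a word. -/
def shiftW (m : ℕ) (w : W) : W := w.map (· + m)

/-- Add `m` to every letter of every word of a sequence of words. -/
def shiftF (m : ℕ) (F : List W) : List W := F.map (shiftW m)

/-- The word whose LR-decomposition is the finite set of words `G`:
sort `G` increasingly (for dominated words with distinct minimal letters the
lexicographic order agrees with comparing the minimal letters) and concatenate
in decreasing order. -/
noncomputable def wordOfSet (G : Finset W) : W := (G.sort (· ≤ ·)).reverse.flatten

/-- Given vertex sets `X`, `Y` (of words) and a set `Θ` of edges, the resulting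
set of words: concatenations `u ++ w` over edges `(u, w) ∈ Θ`, together with all
unmatched words of `X` and of `Y`. -/
noncomputable def glueSet (X Y : Finset W) (Θ : Finset (W × W)) : Finset W :=
  Θ.image (fun p => p.1 ++ p.2) ∪
    X.filter (fun u => ∀ p ∈ Θ, p.1 ≠ u) ∪
    Y.filter (fun w => ∀ p ∈ Θ, p.2 ≠ w)

/-- `R(a,b)` : the set of matchings between `F_a` and `F_b + m` (`m` the length
of `a`), encoded as sets of edges in which no vertex occurs twice. -/
noncomputable def Rset (a b : W) : Finset (Finset (W × W)) :=
  ((LR a).toFinset ×ˢ (shiftF a.length (LR b)).toFinset).powerset.filter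
    (fun Θ => ∀ p ∈ Θ, ∀ q ∈ Θ, (p.1 = q.1 ∨ p.2 = q.2) → p = q)

/-- `aΘb` : the parking function whose LR-decomposition consists of the
concatenations `u ⬝ (w + m)` over the edges `(u, w + m)` of `Θ` together with all
unmatched words of `F_a` and of `F_b + m`. -/
noncomputable def mTheta (a b : W) (Θ : Finset (W × W)) : W :=
  wordOfSet (glueSet (LR a).toFinset (shiftF a.length (LR b)).toFinset Θ)

/-- `d(a) = min { i : #{ j : a_j ≤ i } < i }`. -/
def dVal (a : W) : ℕ :=
  Nat.find (p := fun i => (a.filter (fun x => x ≤ i)).length < i)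
    ⟨a.length + 1, Nat.lt_succ_of_le (List.length_filter_le _ _)⟩

/-- One step of the parkization algorithm: decrement every letter greater
than `d(a)`.  (This is the identity when `a` is a parking function.) -/
def parkStep (a : W) : W := a.map fun x => if dVal a < x then x - 1 else x

/-- Auxiliary fueled version of the parkization algorithm. -/
def parkFuel : ℕ → W → W
  | 0, a => a
  | k + 1, a => if dVal a = a.length + 1 then a else parkFuel k (parkStep a)

/-- The parkization `Park a` of a word `a`.  (For a word with positive letters
the algorithm needs at most `a.sum` steps, so the fuel below suffices.) -/
def Park (a : W) : W := parkFuel a.sum a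

/-- The subword of `a` obtained by keeping exactly the words of `F_a`
belonging to `S`. -/
def subWord (a : W) (S : Finset W) : W := wordOf ((LR a).filter (· ∈ S))

/-- The free module with basis indexed by words; the Hopf algebra `PFSym` is
its submodule spanned by `{M_a : a ∈ P}`. -/
abbrev FW (K : Type) [Field K] : Type := W →₀ K

/-- The monomial basis element `M_a`. -/
noncomputable def Mb (K : Type) [Field K] (a : W) : FW K := Finsupp.single a 1

/-- `M_a ⋆ M_b = Σ_{Θ ∈ R(a,b)} M_{aΘb}` on basis elements. -/
noncomputable def mulSingle (K : Type) [Field K] (a b : W) : FW K :=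
  ∑ Θ ∈ Rset a b, Mb K (mTheta a b Θ)

/-- The product `⋆`, extended bilinearly. -/
noncomputable def starF (K : Type) [Field K] (x y : FW K) : FW K :=
  x.sum fun a ca => y.sum fun b cb => (ca * cb) • mulSingle K a b

/-- The free module with basis indexed by pairs of words; it realizes the
tensor square of `FW K` via `M_a ⊗ M_b ↦ single (a,b)`. -/
abbrev FW2 (K : Type) [Field K] : Type := (W × W) →₀ K

/-- `Δ(M_a) = Σ M_{Park a'} ⊗ M_{Park a''}` over ordered pairs `(a', a'')` of
subwords of `a` with `F_{a'} ⊍ F_{a''} = F_a` (encoded by the subset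
`S ⊆ F_a` of words kept in `a'`). -/
noncomputable def deltaSingle (K : Type) [Field K] (a : W) : FW2 K :=
  ∑ S ∈ ((LR a).toFinset).powerset,
    Finsupp.single
      (Park (subWord a S), Park (subWord a (((LR a).toFinset) \ S))) 1

/-- The coproduct `Δ`, extended linearly. -/
noncomputable def deltaF (K : Type) [Field K] (x : FW K) : FW2 K :=
  x.sum fun a ca => ca • deltaSingle K a

/-- The componentwise product on the tensor square, on basis elements:
`(M_a ⊗ M_b) ⋆ (M_c ⊗ M_d) = (M_a ⋆ M_c) ⊗ (M_b ⋆ M_d)`. -/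
noncomputable def star2Single (K : Type) [Field K] (p q : W × W) : FW2 K :=
  ∑ Θ ∈ Rset p.1 q.1, ∑ Θ' ∈ Rset p.2 q.2,
    Finsupp.single (mTheta p.1 q.1 Θ, mTheta p.2 q.2 Θ') 1

/-- The componentwise product on the tensor square, extended bilinearly. -/
noncomputable def star2F (K : Type) [Field K] (x y : FW2 K) : FW2 K :=
  x.sum fun p cp => y.sum fun q cq => (cp * cq) • star2Single K p q

/-- The counit `ε` on basis elements. -/
noncomputable def epsW (K : Type) [Field K] (a : W) : K := if a = [] then 1 else 0

/-- `F_a ∘ F_b` : concatenate the `i`-th words of `F_a` and `F_b + m`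
for `i ≤ min(r,s)` and keep the remaining unpaired words. -/
def splitLR (F G : List W) : List W :=
  List.zipWith (· ++ ·) F G ++ F.drop G.length ++ G.drop F.length

/-- The split product `a ∘ b`. -/
def splitProd (a b : W) : W := wordOf (splitLR (LR a) (shiftF a.length (LR b)))

/-- A nonempty parking function is unsplitable if it is not the split product
of two nonempty parking functions. -/
def UnsplitablePF (a : W) : Prop :=
  IsPF a ∧ a ≠ [] ∧
    ¬ ∃ b c : W, IsPF b ∧ IsPF c ∧ b ≠ [] ∧ c ≠ [] ∧ a = splitProd b c

/-- The slash product `a | b = (b₁+m) ⋯ (bₙ+m) a₁ ⋯ a_m`. -/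
def slashProd (a b : W) : W := shiftW a.length b ++ a

/-- A nonempty parking function is atomic if it is not the slash product
of two nonempty parking functions. -/
def AtomicPF (a : W) : Prop :=
  IsPF a ∧ a ≠ [] ∧
    ¬ ∃ b c : W, IsPF b ∧ IsPF c ∧ b ≠ [] ∧ c ≠ [] ∧ a = slashProd b c

/-- `u ≺* v` : either `v` is a proper initial subword of `u`, or `u` is not a
proper initial subword of `v` and `u` precedes `v` lexicographically. -/
def precStar (u v : W) : Prop :=
  (v <+: u ∧ v ≠ u) ∨ (¬ (u <+: v ∧ u ≠ v) ∧ List.Lex (· < ·) u v)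

/-- `a ≺*_lex b` : `F_a` strictly precedes `F_b` in the lexicographic order
on sequences of words induced by `≺*`. -/
def precStarLex (a b : W) : Prop := List.Lex precStar (LR a) (LR b)

/-- The covering relation of `≤_*` : `b` covers `a` if `F_b` is obtained from
`F_a = (w_1, …, w_r)` by replacing `w_i` by `w_i ⬝ w_j` and removing `w_j`,
for some `i < j` such that every letter of `w_i` is at most every letter of `w_j`. -/
def CovStar (a b : W) : Prop :=
  ∃ i j, i < j ∧ j < (LR a).length ∧
    (∀ x ∈ (LR a).getD i [], ∀ y ∈ (LR a).getD j [], x ≤ y) ∧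
    LR b = ((LR a).set i ((LR a).getD i [] ++ (LR a).getD j [])).eraseIdx j

/-- The partial order `≤_*` on parking functions, generated by the covering
relations. -/
def leStar (a b : W) : Prop := Relation.ReflTransGen CovStar a b

/-- The finite set of all parking functions of length `n`. -/
noncomputable def pfFinset (n : ℕ) : Finset W :=
  ((Finset.univ : Finset (Fin n → Fin n)).image
      (fun f => List.ofFn fun i => (f i).val + 1)).filter IsPF

/-- The basis element `Q_a = Σ_{a ≤_* b} M_b`. -/
noncomputable def Qb (K : Type) [Field K] (a : W) : FW K :=
  ∑ b ∈ (pfFinset a.length).filter (fun b => leStar a b), Mb K b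

/-- `Q_x ⊗ Q_y` as an element of the tensor square. -/
noncomputable def QT (K : Type) [Field K] (x y : W) : FW2 K :=
  ∑ b ∈ (pfFinset x.length).filter (fun b => leStar x b),
    ∑ c ∈ (pfFinset y.length).filter (fun c => leStar y c),
      Finsupp.single (b, c) 1

/-- `a` is a nonincreasing word. -/
def NonInc (a : W) : Prop := a.Chain' (fun x y => y ≤ x)

/-- Every word of the LR-decomposition of `a` is nondecreasing. -/
def Nprop (a : W) : Prop := ∀ w ∈ LR a, w.Chain' (· ≤ ·)

/-- The words of the LR-decomposition of `a` have pairwise disjoint sets of letters. -/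
def Dprop (a : W) : Prop := (LR a).Pairwise (fun u v => ∀ x ∈ u, x ∉ v)

/-- `a` is a permutation of `{1, …, n}` viewed as a word. -/
def Sprop (a : W) : Prop := a.Perm (List.range' 1 a.length)


def hd (w : W) : ℕ := w.headD 0

def Good (F : List W) : Prop :=
  (∀ w ∈ F, Dominated w) ∧ F.Pairwise (fun u v => hd u < hd v)

theorem segs_flatten (a : W) : (segs a).flatten = a := by
  induction a using segs.induct with
  | case1 => simp [segs]
  | case2 x xs ih =>
    rw [segs, List.flatten_cons, ih, List.cons_append, List.takeWhile_append_dropWhile]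

theorem segs_good (a : W) : (∀ w ∈ segs a, Dominated w) ∧
    (segs a).Pairwise (fun u v => hd v < hd u) ∧ ∀ w ∈ segs a, hd w ≤ hd a := by
  induction a using segs.induct with
  | case1 => simp [segs]
  | case2 x xs ih =>
    obtain ⟨h1, h2, h3⟩ := ih
    have key : ∀ w ∈ segs (xs.dropWhile fun y => x ≤ y), hd w < x := by
      intro w hw
      have h := h3 w hw
      cases hc : xs.dropWhile (fun y => decide (x ≤ y)) with
      | nil => rw [hc] at hw; simp [segs] at hw
      | cons y ys =>
        have h4 : ¬ x ≤ y := by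
          have h5 := List.head?_dropWhile_not (fun y => decide (x ≤ y)) xs
          rw [hc] at h5
          simpa using h5
        rw [hc] at h
        simp [hd] at h ⊢
        omega
    rw [segs]
    refine ⟨?_, ?_, ?_⟩
    · intro w hw
      rcases List.mem_cons.1 hw with rfl | hw
      · refine ⟨by simp, ?_⟩
        intro y hy
        rcases List.mem_cons.1 hy with rfl | hy
        · simp
        · have := List.mem_takeWhile_imp hy
          simpa using this
      · exact h1 w hw
    · rw [List.pairwise_cons]
      refine ⟨fun w hw => ?_, h2⟩
      simpa [hd] using key w hw
    · intro w hw
      rcases List.mem_cons.1 hw with rfl | hw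
      · simp [hd]
      · have := key w hw
        simp only [hd, List.headD_cons] at this ⊢
        omega

theorem LR_good (a : W) : Good (LR a) := by
  obtain ⟨h1, h2, _⟩ := segs_good a
  refine ⟨by simpa [LR] using h1, ?_⟩
  rw [LR, List.pairwise_reverse]
  exact h2

theorem wordOf_LR (a : W) : wordOf (LR a) = a := by
  simp [wordOf, LR, segs_flatten]

theorem segs_of_good (G : List W) (h1 : ∀ w ∈ G, Dominated w)
    (h2 : G.Pairwise (fun u v => hd v < hd u)) : segs G.flatten = G := by
  induction G with
  | nil => simp [segs]
  | cons g G ih =>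
    have ih' := ih (fun w hw => h1 w (by simp [hw])) (List.pairwise_cons.1 h2).2
    obtain ⟨hn, hm⟩ := h1 g (by simp)
    cases g with
    | nil => exact absurd rfl hn
    | cons x w =>
      have hw : ∀ y ∈ w, decide (x ≤ y) = true := by
        intro y hy
        simpa using hm y (by simp [hy])
      have hz : ∀ z zs, G.flatten = z :: zs → z < x := by
        intro z zs hz
        cases G with
        | nil => simp at hz
        | cons k G =>
          obtain ⟨hn', _⟩ := h1 k (by simp)
          have := (List.pairwise_cons.1 h2).1 k (by simp)
          cases k with
          | nil => exact absurd rfl hn'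
          | cons a k =>
            simp [hd] at hz this
            omega
      rw [List.flatten_cons, List.cons_append, segs,
        List.takeWhile_append_of_pos hw, List.dropWhile_append_of_pos hw]
      have e1 : G.flatten.takeWhile (fun y => decide (x ≤ y)) = [] := by
        cases hG : G.flatten with
        | nil => simp
        | cons z zs =>
          have := hz z zs hG
          simp [this]
      have e2 : G.flatten.dropWhile (fun y => decide (x ≤ y)) = G.flatten := by
        cases hG : G.flatten with
        | nil => simp
        | cons z zs =>
          have := hz z zs hG
          simp [this]
      rw [e1, e2, ih']
      simp

theorem LR_wordOf (F : List W) (h : Good F) : LR (wordOf F) = F := by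
  rw [LR, wordOf, segs_of_good]
  · simp
  · simpa using h.1
  · rw [List.pairwise_reverse]; exact h.2

theorem Good.nodup {F : List W} (h : Good F) : F.Nodup := by
  refine h.2.imp ?_
  rintro u v huv rfl
  exact lt_irrefl _ huv

theorem wordOfSet_good (F : List W) (h : Good F) : wordOfSet F.toFinset = wordOf F := by
  have : F.toFinset.sort (· ≤ ·) = F := by
    rw [List.toFinset_sort _ h.nodup]
    refine h.2.imp_of_mem ?_
    intro u v hu hv huv
    have h1 := (h.1 u hu).1
    have h2 := (h.1 v hv).1
    cases u with
    | nil => exact absurd rfl h1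
    | cons x u =>
      cases v with
      | nil => exact absurd rfl h2
      | cons y v =>
        exact le_of_lt (List.Lex.rel huv)
  rw [wordOfSet, this, wordOf]

theorem precStar_nil (v : W) : ¬ precStar [] v := by
  rintro (⟨h1, h2⟩ | ⟨h1, h2⟩)
  · simp at h1; exact h2 h1
  · cases h2; exact h1 ⟨by simp, by simp⟩

theorem precStar_cons_nil (x : ℕ) (u : W) : precStar (x :: u) [] :=
  Or.inl ⟨by simp, by simp⟩

theorem precStar_cons (x y : ℕ) (u v : W) :
    precStar (x :: u) (y :: v) ↔ x < y ∨ (x = y ∧ precStar u v) := by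
  unfold precStar
  rw [List.cons_lex_cons_iff]
  simp only [List.cons_prefix_cons, ne_eq, List.cons.injEq]
  rcases lt_trichotomy x y with h | h | h
  · have : ¬ (x = y) := by omega
    have : ¬ (y = x) := by omega
    simp [*]
  · subst h; simp
  · have : ¬ (x = y) := by omega
    have : ¬ (y = x) := by omega
    have : ¬ (x < y) := by omega
    simp [*]

theorem precStar_trans {u v w : W} (h1 : precStar u v) (h2 : precStar v w) : precStar u w := by
  induction u generalizing v w with
  | nil => exact absurd h1 (precStar_nil _)
  | cons x u ih =>
    cases v with
    | nil => exact absurd h2 (precStar_nil _)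
    | cons y v =>
      cases w with
      | nil => exact precStar_cons_nil _ _
      | cons z w =>
        rw [precStar_cons] at *
        rcases h1 with h1 | ⟨h1, h1'⟩ <;> rcases h2 with h2 | ⟨h2, h2'⟩
        · left; omega
        · left; omega
        · left; omega
        · exact Or.inr ⟨h1.trans h2, ih h1' h2'⟩

theorem precStar_append (p u v : W) : precStar (p ++ u) (p ++ v) ↔ precStar u v := by
  induction p with
  | nil => simp
  | cons x p ih => simp [precStar_cons, ih]

theorem precStar_shift (m : ℕ) (u v : W) (h : precStar u v) :
    precStar (shiftW m u) (shiftW m v) := by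
  induction u generalizing v with
  | nil => exact absurd h (precStar_nil _)
  | cons x u ih =>
    cases v with
    | nil => exact precStar_cons_nil _ _
    | cons y v =>
      simp only [shiftW, List.map_cons, precStar_cons] at *
      rcases h with h | ⟨h, h'⟩
      · left; omega
      · exact Or.inr ⟨by omega, ih v h'⟩

theorem lex_trans {F G H : List W} (h1 : List.Lex precStar F G) (h2 : List.Lex precStar G H) :
    List.Lex precStar F H := by
  induction h1 generalizing H with
  | nil => cases h2 <;> exact List.Lex.nil
  | cons h ih =>
    cases h2 with
    | cons h' => exact List.Lex.cons (ih h')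
    | rel h' => exact List.Lex.rel h'
  | rel h =>
    cases h2 with
    | cons h' => exact List.Lex.rel h
    | rel h' => exact List.Lex.rel (precStar_trans h h')

@[simp] theorem splitLR_nil_left (V : List W) : splitLR [] V = V := by simp [splitLR]
@[simp] theorem splitLR_nil_right (U : List W) : splitLR U [] = U := by simp [splitLR]
@[simp] theorem splitLR_cons (u v : W) (U V : List W) :
    splitLR (u :: U) (v :: V) = (u ++ v) :: splitLR U V := by simp [splitLR]

theorem shift_lex (m : ℕ) {F G : List W} (h : List.Lex precStar F G) :
    List.Lex precStar (shiftF m F) (shiftF m G) := by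
  induction h with
  | nil => exact List.Lex.nil
  | cons h ih => exact List.Lex.cons ih
  | rel h => exact List.Lex.rel (precStar_shift m _ _ h)

theorem split_lex {F G : List W} (h : List.Lex precStar F G)
    (hlen : F.flatten.length = G.flatten.length) (hG : ∀ w ∈ G, w ≠ []) (U : List W) :
    List.Lex precStar (splitLR U F) (splitLR U G) := by
  induction h generalizing U with
  | @nil v G =>
    have := hG v (by simp)
    have := List.length_pos_iff.2 this
    simp only [List.flatten_nil, List.flatten_cons, List.length_append, List.length_nil] at hlen
    omega
  | @cons v F G h ih =>
    cases U with
    | nil => simpa using List.Lex.cons h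
    | cons u U =>
      simp only [splitLR_cons]
      refine List.Lex.cons (ih ?_ (fun w hw => hG w (by simp [hw])) U)
      simpa using hlen
  | @rel v F w G h =>
    cases U with
    | nil => simpa using List.Lex.rel h
    | cons u U =>
      simp only [splitLR_cons]
      exact List.Lex.rel ((precStar_append _ _ _).2 h)

/-- The list form of the glued set. -/
noncomputable def Hl (U V : List W) (e : W → W) : List W :=
  U.map (fun u => u ++ e u) ++ V.filter (fun v => ∀ u ∈ U, e u ≠ v)

theorem glue_compare (U V : List W) (e : W → W) (hU : U.Nodup) (hV : Good V)
    (h1 : ∀ u ∈ U, e u ≠ [] → e u ∈ V)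
    (h2 : ∀ u ∈ U, ∀ u' ∈ U, e u ≠ [] → e u = e u' → u = u') :
    (Hl U V e = splitLR U V ∧ ∀ u ∈ U, ∀ w, w ≠ [] → (e u = w ↔ (u, w) ∈ U.zip V)) ∨
    (List.Lex precStar (splitLR U V) (Hl U V e) ∧ ∃ u v, (u, v) ∈ U.zip V ∧ e u ≠ v) := by
  induction U generalizing V with
  | nil => left; simp [Hl]
  | cons u U ih =>
    cases V with
    | nil =>
      left
      have h0 : ∀ x ∈ u :: U, e x = [] := by
        intro x hx
        by_contra h
        simpa using h1 x hx h
      refine ⟨?_, ?_⟩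
      · simp only [Hl, splitLR_nil_right, List.filter_nil, List.append_nil]
        conv_rhs => rw [← List.map_id (u :: U)]
        apply List.map_congr_left
        intro x hx
        simp [h0 x hx]
      · intro x hx w hw
        rw [h0 x hx]
        simpa using hw.symm
    | cons v V =>
      obtain ⟨huU, hU'⟩ := List.nodup_cons.1 hU
      obtain ⟨hvV, hV'⟩ := List.nodup_cons.1 hV.nodup
      have hvn : v ≠ [] := (hV.1 v (by simp)).1
      by_cases he : e u = v
      · have hne : ∀ x ∈ U, e x ≠ v := by
          intro x hx hxv
          have := h2 u (by simp) x (by simp [hx]) (by rw [he]; exact hvn) (by rw [he, hxv])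
          exact huU (this ▸ hx)
        have hH : Hl (u :: U) (v :: V) e = (u ++ v) :: Hl U V e := by
          simp only [Hl, List.map_cons, List.cons_append, he]
          congr 2
          rw [List.filter_cons_of_neg (by simp [he])]
          apply List.filter_congr
          intro z hz
          have : z ≠ v := fun h => hvV (h ▸ hz)
          simp [he, this.symm]
        rcases ih V hU' ⟨fun w hw => hV.1 w (by simp [hw]), (List.pairwise_cons.1 hV.2).2⟩
          (fun x hx hn => by
            rcases List.mem_cons.1 (h1 x (by simp [hx]) hn) with h | h
            · exact absurd h (hne x hx)
            · exact h)
          (fun x hx y hy => h2 x (by simp [hx]) y (by simp [hy])) with ⟨ha, hb⟩ | ⟨ha, hb⟩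
        · left
          refine ⟨by rw [hH, ha, splitLR_cons], ?_⟩
          intro x hx w hw
          rw [List.zip_cons_cons, List.mem_cons, Prod.mk.injEq]
          rcases List.mem_cons.1 hx with rfl | hx
          · rw [he]
            constructor
            · rintro rfl; simp
            · rintro (h | h)
              · exact h.2.symm
              · exact absurd (List.of_mem_zip h).1 huU
          · have : x ≠ u := fun h => huU (h ▸ hx)
            simp [this, hb x hx w hw]
        · right
          rw [hH, splitLR_cons]
          refine ⟨List.Lex.cons ha, ?_⟩
          obtain ⟨x, y, hxy, hh⟩ := hb
          exact ⟨x, y, by simp [hxy], hh⟩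
      · right
        refine ⟨?_, u, v, by simp, he⟩
        simp only [Hl, List.map_cons, List.cons_append, splitLR_cons]
        apply List.Lex.rel
        rw [precStar_append]
        cases hv : v with
        | nil => exact absurd hv hvn
        | cons y v' =>
          cases hu : e u with
          | nil => exact precStar_cons_nil _ _
          | cons z w' =>
            have hm := h1 u (by simp) (by simp [hu])
            rcases List.mem_cons.1 hm with h | h
            · exact absurd h he
            · have := (List.pairwise_cons.1 hV.2).1 _ h
              rw [hu, hv] at this
              simp [hd] at this
              rw [precStar_cons]
              exact Or.inl this

theorem Hl_good (U V : List W) (e : W → W) (hU : Good U) (hV : Good V)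
    (h1 : ∀ u ∈ U, e u ≠ [] → e u ∈ V)
    (hc : ∀ u ∈ U, ∀ v ∈ V, ∀ s ∈ u, ∀ t ∈ v, s < t) : Good (Hl U V e) := by
  have hh : ∀ u ∈ U, hd (u ++ e u) = hd u := by
    intro u hu
    cases u with
    | nil => exact absurd rfl (hU.1 _ hu).1
    | cons x u => simp [hd]
  have hmem : ∀ {F : List W}, Good F → ∀ u ∈ F, hd u ∈ u := by
    intro F hF u hu
    cases u with
    | nil => exact absurd rfl (hF.1 _ hu).1
    | cons x u => simp [hd]
  refine ⟨?_, ?_⟩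
  · intro w hw
    rcases List.mem_append.1 hw with hw | hw
    · obtain ⟨u, hu, rfl⟩ := List.mem_map.1 hw
      have hd1 := hU.1 u hu
      refine ⟨by simp [hd1.1], ?_⟩
      intro x hx
      have := hh u hu
      unfold hd at this
      simp only [this]
      rcases List.mem_append.1 hx with hx | hx
      · exact hd1.2 x hx
      · exact le_of_lt (hc u hu _ (h1 u hu (List.ne_nil_of_mem hx)) _ (hmem hU u hu) _ hx)
    · exact hV.1 w (List.mem_of_mem_filter hw)
  · rw [Hl, List.pairwise_append, List.pairwise_map]
    refine ⟨?_, hV.2.filter _, ?_⟩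
    · refine hU.2.imp_of_mem ?_
      intro u v hu hv h
      rw [hh u hu, hh v hv]
      exact h
    · intro w hw v hv
      obtain ⟨u, hu, rfl⟩ := List.mem_map.1 hw
      rw [hh u hu]
      have hv := List.mem_of_mem_filter hv
      exact hc u hu v hv _ (hmem hU u hu) _ (hmem hV v hv)

theorem Hl_perm (U V : List W) (e : W → W) (hU : U.Nodup) (hV : V.Nodup) (hVn : ∀ v ∈ V, v ≠ [])
    (h1 : ∀ u ∈ U, e u ≠ [] → e u ∈ V)
    (h2 : ∀ u ∈ U, ∀ u' ∈ U, e u ≠ [] → e u = e u' → u = u') :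
    (Hl U V e).flatten.Perm (U.flatten ++ V.flatten) := by
  induction U generalizing V with
  | nil => simp [Hl]
  | cons u U ih =>
    obtain ⟨huU, hU'⟩ := List.nodup_cons.1 hU
    by_cases he : e u = []
    · have := ih V hU' hV hVn (fun x hx => h1 x (by simp [hx]))
        (fun x hx y hy => h2 x (by simp [hx]) y (by simp [hy]))
      have hH : Hl (u :: U) V e = u :: Hl U V e := by
        simp only [Hl, List.map_cons, List.cons_append, he, List.append_nil]
        congr 2
        apply List.filter_congr
        intro z hz
        simp [he, (hVn z hz).symm]
      rw [hH, List.flatten_cons, List.flatten_cons, List.append_assoc]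
      exact this.append_left u
    · have hm := h1 u (by simp) he
      have hne : ∀ x ∈ U, e x ≠ e u := by
        intro x hx hxv
        have := h2 u (by simp) x (by simp [hx]) he hxv.symm
        exact huU (this ▸ hx)
      have := ih (V.erase (e u)) hU' (hV.erase _) (fun v hv => hVn v (List.mem_of_mem_erase hv))
        (fun x hx hn => (List.mem_erase_of_ne (hne x hx)).2 (h1 x (by simp [hx]) hn))
        (fun x hx y hy => h2 x (by simp [hx]) y (by simp [hy]))
      have hH : Hl (u :: U) V e = (u ++ e u) :: Hl U (V.erase (e u)) e := by
        simp only [Hl, List.map_cons, List.cons_append]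
        congr 2
        rw [hV.erase_eq_filter, List.filter_filter]
        apply List.filter_congr
        intro z hz
        by_cases hz : z = e u
        · simp [hz]
        · have : e u ≠ z := fun h => hz h.symm
          simp [hz, this]
      rw [hH]
      have hp : V.flatten.Perm (e u ++ (V.erase (e u)).flatten) := by
        simpa using (List.perm_cons_erase hm).flatten
      have h3 : (u ++ e u ++ (Hl U (V.erase (e u)) e).flatten).Perm
          (u ++ e u ++ (U.flatten ++ (V.erase (e u)).flatten)) := this.append_left _
      have h4 : ((u :: U).flatten ++ V.flatten).Perm
          ((u :: U).flatten ++ (e u ++ (V.erase (e u)).flatten)) := hp.append_left _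
      refine (by simpa using h3 : List.Perm _ _).trans (List.Perm.trans ?_ h4.symm)
      simp only [List.flatten_cons, List.append_assoc]
      apply List.Perm.append_left
      rw [← List.append_assoc, ← List.append_assoc]
      exact List.perm_append_comm.append_right _

theorem sort_perm {a b : W} (h : a.Perm b) :
    a.insertionSort (· ≤ ·) = b.insertionSort (· ≤ ·) := by
  apply List.Perm.eq_of_pairwise' (r := (· ≤ ·)) (List.pairwise_insertionSort _ _)
    (List.pairwise_insertionSort _ _)
  exact (List.perm_insertionSort _ _).trans (h.trans (List.perm_insertionSort _ _).symm)

theorem IsPF_perm {a b : W} (h : a.Perm b) (ha : IsPF a) : IsPF b := by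
  refine ⟨fun x hx => ha.1 x (h.mem_iff.2 hx), ?_⟩
  rw [← sort_perm h, ← h.length_eq]
  exact ha.2

theorem IsPF_le {a : W} (ha : IsPF a) : ∀ x ∈ a, x ≤ a.length := by
  intro x hx
  have hx' := (List.perm_insertionSort (· ≤ ·) a).mem_iff.2 hx
  obtain ⟨i, hi, rfl⟩ := List.getElem_of_mem hx'
  have hi' : i < a.length := by simpa using hi
  have := ha.2 i hi'
  rw [List.getD_eq_getElem _ _ hi] at this
  omega

theorem IsPF_append {a b : W} (ha : IsPF a) (hb : IsPF b) :
    IsPF (a ++ shiftW a.length b) := by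
  have hs : (a ++ shiftW a.length b).insertionSort (· ≤ ·) =
      a.insertionSort (· ≤ ·) ++ shiftW a.length (b.insertionSort (· ≤ ·)) := by
    apply List.Perm.eq_of_pairwise' (r := (· ≤ ·)) (List.pairwise_insertionSort _ _)
    · rw [List.pairwise_append]
      refine ⟨List.pairwise_insertionSort _ _, ?_, ?_⟩
      · rw [shiftW, List.pairwise_map]
        exact (List.pairwise_insertionSort (· ≤ ·) b).imp (fun h => by omega)
      · intro x hx y hy
        have := IsPF_le ha x ((List.perm_insertionSort (· ≤ ·) a).mem_iff.1 hx)
        obtain ⟨z, _, rfl⟩ := List.mem_map.1 hy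
        omega
    · refine (List.perm_insertionSort _ _).trans ?_
      exact (List.perm_insertionSort _ _).symm.append ((List.perm_insertionSort _ _).symm.map _)
  refine ⟨?_, ?_⟩
  · intro x hx
    rcases List.mem_append.1 hx with hx | hx
    · exact ha.1 x hx
    · obtain ⟨z, hz, rfl⟩ := List.mem_map.1 hx
      have := hb.1 z hz
      omega
  · intro i hi
    rw [hs]
    simp only [shiftW, List.length_append, List.length_map] at hi
    by_cases h : i < a.length
    · rw [List.getD_append _ _ _ _ (by simpa using h)]
      exact ha.2 i h
    · rw [List.getD_append_right _ _ _ _ (by simpa using h)]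
      have hi2 : i - a.length < b.length := by omega
      have := hb.2 _ hi2
      have hl : i - a.length < (b.insertionSort (· ≤ ·)).length := by simpa using hi2
      rw [List.getD_eq_getElem _ _ hl] at this
      rw [List.length_insertionSort, shiftW, List.getD_eq_getElem _ _ (by simpa using hi2),
        List.getElem_map]
      omega

theorem mem_pfFinset (n : ℕ) (b : W) : b ∈ pfFinset n ↔ IsPF b ∧ b.length = n := by
  unfold pfFinset
  rw [Finset.mem_filter, Finset.mem_image]
  constructor
  · rintro ⟨⟨f, _, rfl⟩, h⟩
    exact ⟨h, by simp⟩
  · rintro ⟨h, rfl⟩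
    refine ⟨⟨fun i => ⟨b[i] - 1, ?_⟩, Finset.mem_univ _, ?_⟩, h⟩
    · have h1 := IsPF_le h b[i] (by simp)
      have h2 := h.1 b[i] (by simp)
      omega
    · apply List.ext_getElem
      · simp
      · intro i h1 h2
        have h3 := h.1 b[i] (by simp)
        simp
        omega

theorem shift_good (m : ℕ) {F : List W} (h : Good F) : Good (shiftF m F) := by
  have hh : ∀ u ∈ F, hd (shiftW m u) = hd u + m := by
    intro u hu
    cases u with
    | nil => exact absurd rfl (h.1 _ hu).1
    | cons x u => simp [hd, shiftW]
  refine ⟨?_, ?_⟩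
  · intro w hw
    obtain ⟨u, hu, rfl⟩ := List.mem_map.1 hw
    refine ⟨by simpa [shiftW] using (h.1 u hu).1, ?_⟩
    intro x hx
    obtain ⟨y, hy, rfl⟩ := List.mem_map.1 hx
    have h1 := hh u hu
    have h2 := (h.1 u hu).2 y hy
    unfold hd at h1
    omega
  · rw [shiftF, List.pairwise_map]
    refine h.2.imp_of_mem ?_
    intro u v hu hv huv
    rw [hh u hu, hh v hv]
    omega

theorem LR_flatten_perm (a : W) : (LR a).flatten.Perm a := by
  conv_rhs => rw [← segs_flatten a]
  exact (List.reverse_perm _).flatten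

theorem shift_flatten (m : ℕ) (F : List W) : (shiftF m F).flatten = shiftW m F.flatten := by
  simp [shiftF, shiftW, List.map_flatten]
  rfl

theorem exists_e (Θ : Finset (W × W))
    (hm : ∀ p ∈ Θ, ∀ q ∈ Θ, (p.1 = q.1 ∨ p.2 = q.2) → p = q) :
    ∃ e : W → W, (∀ u w, (u, w) ∈ Θ → e u = w) ∧ ∀ u, e u ≠ [] → (u, e u) ∈ Θ := by
  refine ⟨fun u => if h : ∃ w, (u, w) ∈ Θ then h.choose else [], ?_, ?_⟩
  · intro u w h
    have hex : ∃ w, (u, w) ∈ Θ := ⟨w, h⟩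
    simp only [dif_pos hex]
    have := hm _ hex.choose_spec _ h (Or.inl rfl)
    exact congrArg Prod.snd this
  · intro u hu
    by_cases hex : ∃ w, (u, w) ∈ Θ
    · simp only [dif_pos hex]
      exact hex.choose_spec
    · simp [hex] at hu

theorem glue_eq (U V : List W) (Θ : Finset (W × W)) (e : W → W)
    (hsub : ∀ p ∈ Θ, p.1 ∈ U ∧ p.2 ∈ V) (hVn : ∀ v ∈ V, v ≠ [])
    (he1 : ∀ u w, (u, w) ∈ Θ → e u = w) (he2 : ∀ u, e u ≠ [] → (u, e u) ∈ Θ) :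
    glueSet U.toFinset V.toFinset Θ = (Hl U V e).toFinset := by
  ext t
  simp only [glueSet, Hl, Finset.mem_union, Finset.mem_image, Finset.mem_filter,
    List.mem_toFinset, List.mem_append, List.mem_map, List.mem_filter, decide_eq_true_eq]
  constructor
  · rintro ((⟨p, hp, rfl⟩ | ⟨ht, hp⟩) | ⟨ht, hp⟩)
    · left
      exact ⟨p.1, (hsub p hp).1, by rw [he1 p.1 p.2 hp]⟩
    · left
      refine ⟨t, ht, ?_⟩
      have : e t = [] := by
        by_contra h
        exact hp _ (he2 t h) rfl
      simp [this]
    · right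
      refine ⟨ht, ?_⟩
      rintro u hu rfl
      exact hp _ (he2 u (hVn _ ht)) rfl
  · rintro (⟨u, hu, rfl⟩ | ⟨ht, hp⟩)
    · left
      by_cases h : e u = []
      · right
        rw [h, List.append_nil]
        refine ⟨hu, ?_⟩
        rintro p hp rfl
        have := he1 p.1 p.2 hp
        exact hVn _ (hsub p hp).2 (this ▸ h)
      · left
        exact ⟨_, he2 u h, rfl⟩
    · right
      refine ⟨ht, ?_⟩
      rintro p hq rfl
      exact hp p.1 (hsub p hq).1 (he1 p.1 p.2 hq)

theorem zip_inj {U V : List W} (hU : U.Nodup) (hV : V.Nodup) :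
    ∀ p ∈ U.zip V, ∀ q ∈ U.zip V, (p.1 = q.1 ∨ p.2 = q.2) → p = q := by
  induction U generalizing V with
  | nil => simp
  | cons u U ih =>
    cases V with
    | nil => simp
    | cons v V =>
      obtain ⟨hu, hU'⟩ := List.nodup_cons.1 hU
      obtain ⟨hv, hV'⟩ := List.nodup_cons.1 hV
      intro p hp q hq h
      rw [List.zip_cons_cons, List.mem_cons] at hp hq
      rcases hp with rfl | hp <;> rcases hq with rfl | hq
      · rfl
      · have := List.of_mem_zip (a := q.1) (b := q.2) hq
        rcases h with h | h
        · simp only at h; rw [← h] at this; exact absurd this.1 hu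
        · simp only at h; rw [← h] at this; exact absurd this.2 hv
      · have := List.of_mem_zip (a := p.1) (b := p.2) hp
        rcases h with h | h
        · simp only at h; rw [h] at this; exact absurd this.1 hu
        · simp only at h; rw [h] at this; exact absurd this.2 hv
      · exact ih hU' hV' p hp q hq h

theorem mTheta_spec (x b : W) (hx : IsPF x) (hb : IsPF b) :
    ∃ Θ₀ ∈ Rset x b, mTheta x b Θ₀ = splitProd x b ∧
      LR (splitProd x b) = splitLR (LR x) (shiftF x.length (LR b)) ∧
      ∀ Θ ∈ Rset x b, IsPF (mTheta x b Θ) ∧ (mTheta x b Θ).length = x.length + b.length ∧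
        (Θ ≠ Θ₀ → precStarLex (splitProd x b) (mTheta x b Θ)) := by
  have hU : Good (LR x) := LR_good x
  have hV : Good (shiftF x.length (LR b)) := shift_good _ (LR_good b)
  have hVp : (shiftF x.length (LR b)).flatten.Perm (shiftW x.length b) := by
    rw [shift_flatten]
    exact (LR_flatten_perm b).map _
  have hUp := LR_flatten_perm x
  have hc : ∀ u ∈ LR x, ∀ v ∈ shiftF x.length (LR b), ∀ s ∈ u, ∀ t ∈ v, s < t := by
    intro u hu v hv s hs t ht
    have h1 : s ∈ x := hUp.mem_iff.1 (List.mem_flatten.2 ⟨u, hu, hs⟩)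
    have h2 : t ∈ shiftW x.length b := hVp.mem_iff.1 (List.mem_flatten.2 ⟨v, hv, ht⟩)
    obtain ⟨z, hz, rfl⟩ := List.mem_map.1 h2
    have := IsPF_le hx s h1
    have := hb.1 z hz
    omega
  generalize hUe : LR x = U at *
  generalize hVe : shiftF x.length (LR b) = V at *
  have hVn : ∀ v ∈ V, v ≠ [] := fun v hv => (hV.1 v hv).1
  have main : ∀ Θ ∈ Rset x b, ∃ e : W → W,
      (∀ u w, (u, w) ∈ Θ → e u = w) ∧ (∀ u, e u ≠ [] → (u, e u) ∈ Θ) ∧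
      (∀ p ∈ Θ, p.1 ∈ U ∧ p.2 ∈ V) ∧
      mTheta x b Θ = wordOf (Hl U V e) ∧ LR (mTheta x b Θ) = Hl U V e ∧
      (mTheta x b Θ).Perm (x ++ shiftW x.length b) ∧
      ((Hl U V e = splitLR U V ∧ ∀ u ∈ U, ∀ w, w ≠ [] → (e u = w ↔ (u, w) ∈ U.zip V)) ∨
      (List.Lex precStar (splitLR U V) (Hl U V e) ∧ ∃ u v, (u, v) ∈ U.zip V ∧ e u ≠ v)) := by
    intro Θ hΘ
    rw [Rset, Finset.mem_filter, Finset.mem_powerset, hUe, hVe] at hΘ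
    obtain ⟨hs, hm⟩ := hΘ
    have hsub : ∀ p ∈ Θ, p.1 ∈ U ∧ p.2 ∈ V := by
      intro p hp
      simpa using hs hp
    obtain ⟨e, he1, he2⟩ := exists_e Θ hm
    have h1 : ∀ u ∈ U, e u ≠ [] → e u ∈ V := fun u _ h => (hsub _ (he2 u h)).2
    have h2 : ∀ u ∈ U, ∀ u' ∈ U, e u ≠ [] → e u = e u' → u = u' := by
      intro u _ u' _ hn h
      have := hm _ (he2 u hn) _ (he2 u' (h ▸ hn)) (Or.inr h)
      exact congrArg Prod.fst this
    have hg := Hl_good U V e hU hV h1 hc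
    have hmt : mTheta x b Θ = wordOf (Hl U V e) := by
      rw [mTheta, hUe, hVe, glue_eq U V Θ e hsub hVn he1 he2, wordOfSet_good _ hg]
    refine ⟨e, he1, he2, hsub, hmt, by rw [hmt, LR_wordOf _ hg], ?_,
      glue_compare U V e hU.nodup hV h1 h2⟩
    rw [hmt, wordOf]
    refine (List.reverse_perm _).flatten.trans ?_
    exact (Hl_perm U V e hU.nodup hV.nodup hVn h1 h2).trans (hUp.append hVp)
  have h0 : (U.zip V).toFinset ∈ Rset x b := by
    rw [Rset, Finset.mem_filter, Finset.mem_powerset, hUe, hVe]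
    refine ⟨?_, ?_⟩
    · rintro ⟨u, v⟩ h
      rw [List.mem_toFinset] at h
      have := List.of_mem_zip h
      simpa using this
    · intro p hp q hq
      exact zip_inj hU.nodup hV.nodup p (List.mem_toFinset.1 hp) q (List.mem_toFinset.1 hq)
  have hsp : splitProd x b = wordOf (splitLR U V) := by rw [splitProd, hUe, hVe]
  obtain ⟨e, he1, he2, -, hmt, hlr, -, hcmp⟩ := main _ h0
  have hEq : Hl U V e = splitLR U V := by
    rcases hcmp with h | ⟨-, u, v, huv, hne⟩
    · exact h.1
    · exact absurd (he1 u v (List.mem_toFinset.2 huv)) hne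
  have hmt' : mTheta x b (U.zip V).toFinset = splitProd x b := by rw [hmt, hEq, hsp]
  have hlr' : LR (splitProd x b) = splitLR U V := by rw [← hmt', hlr, hEq]
  refine ⟨_, h0, hmt', hlr', ?_⟩
  intro Θ hΘ
  obtain ⟨f, hf1, hf2, hsub, -, hlrf, hperm, hcmpf⟩ := main Θ hΘ
  refine ⟨IsPF_perm hperm.symm (IsPF_append hx hb), ?_, ?_⟩
  · rw [hperm.length_eq]; simp [shiftW]
  · intro hne
    rcases hcmpf with ⟨-, hh⟩ | ⟨hh, -⟩
    · exfalso
      apply hne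
      ext ⟨u, w⟩
      rw [List.mem_toFinset]
      constructor
      · intro h
        have hs := hsub _ h
        exact (hh u hs.1 w (hVn w hs.2)).1 (hf1 u w h)
      · intro h
        have hs := List.of_mem_zip h
        have hw := hVn w hs.2
        have := (hh u hs.1 w hw).2 h
        have h3 := hf2 u (by rw [this]; exact hw)
        rwa [this] at h3
    · rw [precStarLex, hlr', hlrf]
      exact hh

/-- Cone of nonnegative integer combinations of larger basis elements. -/
noncomputable def cone (K : Type) [Field K] (a : W) : AddSubmonoid (FW K) :=
  AddSubmonoid.closure {y | ∃ b, IsPF b ∧ b.length = a.length ∧ precStarLex a b ∧ y = Mb K b}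

theorem starF_Mb (K : Type) [Field K] (x b : W) :
    starF K (Mb K x) (Mb K b) = mulSingle K x b := by
  simp [starF, Mb, Finsupp.sum_single_index]

theorem starF_add (K : Type) [Field K] (x y z : FW K) :
    starF K x (y + z) = starF K x y + starF K x z := by
  unfold starF
  rw [← Finsupp.sum_add]
  congr 1
  ext1 a
  ext1 c
  rw [Finsupp.sum_add_index' (by simp) (by intros; rw [mul_add, add_smul])]

theorem starF_zero (K : Type) [Field K] (x : FW K) : starF K x 0 = 0 := by
  simp [starF]

theorem lex_step (x b c : W) (hx : IsPF x) (hb : IsPF b) (hc : IsPF c)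
    (hl : b.length = c.length) (h : precStarLex c b) :
    precStarLex (splitProd x c) (splitProd x b) := by
  obtain ⟨_, _, _, h1, _⟩ := mTheta_spec x b hx hb
  obtain ⟨_, _, _, h2, _⟩ := mTheta_spec x c hx hc
  rw [precStarLex, h1, h2]
  apply split_lex (shift_lex _ h)
  · rw [shift_flatten, shift_flatten]
    simp only [shiftW, List.length_map]
    rw [(LR_flatten_perm c).length_eq, (LR_flatten_perm b).length_eq, hl]
  · intro w hw
    exact ((shift_good _ (LR_good b)).1 w hw).1

theorem step_tail (K : Type) [Field K] (x c : W) (hx : IsPF x) (hc : IsPF c) (z : FW K)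
    (hz : z ∈ cone K c) : starF K (Mb K x) z ∈ cone K (splitProd x c) := by
  obtain ⟨Θ₀, h0, he, -, hall⟩ := mTheta_spec x c hx hc
  have hlen : (splitProd x c).length = x.length + c.length := by
    rw [← he]; exact (hall _ h0).2.1
  induction hz using AddSubmonoid.closure_induction with
  | zero => rw [starF_zero]; exact zero_mem _
  | add y z _ _ h1 h2 => rw [starF_add]; exact add_mem h1 h2
  | mem y hy =>
    obtain ⟨b, hb, hbl, hlt, rfl⟩ := hy
    rw [starF_Mb, mulSingle]
    apply sum_mem
    intro Θ hΘ
    obtain ⟨Θ₁, h1, he1, -, hall1⟩ := mTheta_spec x b hx hb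
    obtain ⟨hp, hpl, hlex⟩ := hall1 Θ hΘ
    apply AddSubmonoid.subset_closure
    refine ⟨_, hp, by rw [hpl, hlen, hbl], ?_, rfl⟩
    have hs := lex_step x b c hx hb hc hbl hlt
    by_cases hT : Θ = Θ₁
    · rw [hT, he1]; exact hs
    · exact lex_trans hs (hlex hT)

theorem step_head (K : Type) [Field K] (x c : W) (hx : IsPF x) (hc : IsPF c) :
    IsPF (splitProd x c) ∧
    ∃ z ∈ cone K (splitProd x c), starF K (Mb K x) (Mb K c) = Mb K (splitProd x c) + z := by
  obtain ⟨Θ₀, h0, he, -, hall⟩ := mTheta_spec x c hx hc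
  have hlen : (splitProd x c).length = x.length + c.length := by
    rw [← he]; exact (hall _ h0).2.1
  refine ⟨by rw [← he]; exact (hall _ h0).1, ?_⟩
  refine ⟨∑ Θ ∈ (Rset x c).erase Θ₀, Mb K (mTheta x c Θ), ?_, ?_⟩
  · apply sum_mem
    intro Θ hΘ
    obtain ⟨hne, hm⟩ := Finset.mem_erase.1 hΘ
    obtain ⟨hp, hpl, hlex⟩ := hall Θ hm
    exact AddSubmonoid.subset_closure ⟨_, hp, by rw [hpl, hlen], hlex hne, rfl⟩
  · rw [starF_Mb, mulSingle, ← Finset.add_sum_erase _ _ h0, he]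

theorem fold_main (K : Type) [Field K] (L : List W) (hL : ∀ x ∈ L, IsPF x) :
    IsPF (L.foldr splitProd []) ∧
    ∃ z ∈ cone K (L.foldr splitProd []),
      L.foldr (fun x acc => starF K (Mb K x) acc) (Mb K []) =
        Mb K (L.foldr splitProd []) + z := by
  induction L with
  | nil => exact ⟨⟨by simp, by simp⟩, 0, zero_mem _, by simp⟩
  | cons x L ih =>
    obtain ⟨hp, z, hz, h⟩ := ih (fun y hy => hL y (by simp [hy]))
    have hx := hL x (by simp)
    obtain ⟨hp', z', hz', h'⟩ := step_head K x _ hx hp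
    refine ⟨hp', _, add_mem hz' (step_tail K x _ hx hp z hz), ?_⟩
    simp only [List.foldr_cons]
    rw [h, starF_add, h', add_assoc]

theorem cone_sum (K : Type) [Field K] (a : W) (z : FW K) (hz : z ∈ cone K a) :
    ∃ g : W → ℕ, z = ∑ b ∈ (pfFinset a.length).filter (fun b => precStarLex a b),
            (g b : K) • Mb K b := by
  induction hz using AddSubmonoid.closure_induction with
  | zero => exact ⟨fun _ => 0, by simp⟩
  | add y z _ _ h1 h2 =>
    obtain ⟨g, rfl⟩ := h1
    obtain ⟨g', rfl⟩ := h2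
    refine ⟨fun b => g b + g' b, ?_⟩
    rw [← Finset.sum_add_distrib]
    apply Finset.sum_congr rfl
    intro b _
    rw [Nat.cast_add, add_smul]
  | mem y hy =>
    obtain ⟨b, hb, hbl, hlt, rfl⟩ := hy
    refine ⟨fun c => if c = b then 1 else 0, ?_⟩
    rw [Finset.sum_eq_single b]
    · simp
    · intro c _ hc
      simp [hc]
    · intro h
      exact absurd (Finset.mem_filter.2 ⟨(mem_pfFinset _ _).2 ⟨hb, hbl⟩, hlt⟩) h

/-- If `a = a⁽¹⁾ ∘ ⋯ ∘ a⁽ᵏ⁾` is the factorization of a nonempty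
parking function into unsplitable parking functions and
`R_a = M_{a⁽¹⁾} ⋆ ⋯ ⋆ M_{a⁽ᵏ⁾}`, then
`R_a = M_a + Σ_{a ≺*_lex b} c_b M_b` with nonnegative integer coefficients. -/
theorem stmt9 (K : Type) [Field K] [CharZero K] (a : W) (ha : IsPF a) (hne : a ≠ [])
    (L : List W) (hL : ∀ x ∈ L, UnsplitablePF x) (hfac : L.foldr splitProd [] = a) :
    ∃ g : W → ℕ,
      L.foldr (fun x acc => starF K (Mb K x) acc) (Mb K []) =
        Mb K a +
          ∑ b ∈ (pfFinset a.length).filter (fun b => precStarLex a b),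
            (g b : K) • Mb K b := by
  subst hfac
  obtain ⟨_, z, hz, h⟩ := fold_main K L (fun x hx => (hL x hx).1)
  obtain ⟨g, hg⟩ := cone_sum K _ z hz
  exact ⟨g, by rw [h, hg]⟩
end

section
/- Every nonempty parking function a admits a unique factorization a = a^(1) | a^(2) | ⋯ | a^(r) as a slash product of atomic parking functions. -/
open scoped Classical

theorem sorted_count (s : List ℕ) (hs : s.Pairwise (· ≤ ·)) (k : ℕ) :
    ∀ i, i < s.length → (s.getD i 0 ≤ k ↔ i < s.countP (fun x => decide (x ≤ k))) := by
  induction s with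
  | nil => intro i hi; simp at hi
  | cons x t ih =>
    rw [List.pairwise_cons] at hs
    obtain ⟨hx, ht⟩ := hs
    have key : ¬ x ≤ k → t.countP (fun x => decide (x ≤ k)) = 0 := by
      intro h
      rw [List.countP_eq_zero]
      intro y hy
      have := hx y hy
      simp
      omega
    intro i hi
    rw [List.countP_cons]
    cases i with
    | zero =>
      by_cases h : x ≤ k
      · simp [h]
      · simp [h]
        intro y hy
        have := hx y hy
        omega
    | succ i =>
      have hi' : i < t.length := by simpa using hi
      have := ih ht i hi'
      by_cases h : x ≤ k
      · simp only [List.getD_cons_succ, this, h]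
        simp
      · have h0 := key h
        rw [h0] at this
        simp only [List.getD_cons_succ, this, h, h0]
        simp

theorem isPF_iff (a : W) : IsPF a ↔ (∀ x ∈ a, 1 ≤ x) ∧
    ∀ i, i ≤ a.length → i ≤ a.countP (fun x => decide (x ≤ i)) := by
  unfold IsPF
  have hs : (a.insertionSort (· ≤ ·)).Pairwise (· ≤ ·) := List.pairwise_insertionSort _ _
  have hp : (a.insertionSort (· ≤ ·)).Perm a := List.perm_insertionSort _ _
  have hl := hp.length_eq
  apply and_congr_right
  intro _
  constructor
  · intro h i hi
    cases i with
    | zero => simp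
    | succ i =>
      have h1 := h i (by omega)
      rw [sorted_count _ hs _ _ (by omega), hp.countP_eq] at h1
      omega
  · intro h i hi
    rw [sorted_count _ hs _ _ (by omega), hp.countP_eq]
    have := h (i+1) (by omega)
    omega

theorem isPF_count_big (a : W) (ha : IsPF a) (k : ℕ) (hk : a.length ≤ k) :
    a.countP (fun x => decide (x ≤ k)) = a.length := by
  have h1 := ((isPF_iff a).1 ha).2 a.length le_rfl
  have h2 : a.countP (fun x => decide (x ≤ a.length)) ≤ a.countP (fun x => decide (x ≤ k)) := by
    apply List.countP_mono_left
    intro x _ h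
    simp at h ⊢
    omega
  have h3 : a.countP (fun x => decide (x ≤ k)) ≤ a.length := List.countP_le_length
  omega

theorem count_shift (m i : ℕ) (v : W) :
    (shiftW m v).countP (fun x => decide (x ≤ m + i)) = v.countP (fun x => decide (x ≤ i)) := by
  unfold shiftW
  rw [List.countP_map]
  congr 1
  funext x
  simp only [Function.comp]
  congr 1
  apply propext
  omega

theorem length_shiftW (m : ℕ) (v : W) : (shiftW m v).length = v.length := by
  simp [shiftW]

theorem length_slash (a b : W) : (slashProd a b).length = a.length + b.length := by
  simp [slashProd, shiftW, Nat.add_comm]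

theorem slash_nil (a : W) : slashProd a [] = a := by simp [slashProd, shiftW]

theorem nil_slash (a : W) : slashProd [] a = a := by simp [slashProd, shiftW]

theorem slash_assoc (a b c : W) :
    slashProd (slashProd a b) c = slashProd a (slashProd b c) := by
  simp [slashProd, shiftW, Function.comp_def, Nat.add_assoc]

theorem isPF_slash (a b : W) (ha : IsPF a) (hb : IsPF b) : IsPF (slashProd a b) := by
  have hA := (isPF_iff a).1 ha
  have hB := (isPF_iff b).1 hb
  rw [isPF_iff]
  refine ⟨?_, ?_⟩
  · intro x hx
    simp only [slashProd, shiftW, List.mem_append, List.mem_map] at hx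
    rcases hx with ⟨y, hy, rfl⟩ | hx
    · have := hB.1 y hy
      omega
    · exact hA.1 x hx
  · intro i hi
    rw [length_slash] at hi
    unfold slashProd
    rw [List.countP_append]
    by_cases h : i ≤ a.length
    · have := hA.2 i h
      omega
    · obtain ⟨j, rfl⟩ := Nat.exists_eq_add_of_le (le_of_not_ge h)
      rw [count_shift, isPF_count_big a ha _ (by omega)]
      have := hB.2 j (by omega)
      omega

theorem isPF_of_slash (a b : W) (ha : IsPF a) (hb : ∀ x ∈ b, 1 ≤ x)
    (hab : IsPF (slashProd a b)) : IsPF b := by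
  have hAB := (isPF_iff _).1 hab
  rw [isPF_iff]
  refine ⟨hb, ?_⟩
  intro i hi
  have := hAB.2 (a.length + i) (by rw [length_slash]; omega)
  unfold slashProd at this
  rw [List.countP_append, count_shift, isPF_count_big a ha _ (by omega)] at this
  omega

theorem isPF_nil : IsPF [] := by simp [IsPF]

theorem foldl_slash (L : List W) (b : W) :
    L.foldl slashProd b = slashProd b (L.foldl slashProd []) := by
  induction L generalizing b with
  | nil => simp [slash_nil]
  | cons x t ih =>
    rw [List.foldl_cons, List.foldl_cons, ih (slashProd b x), ih (slashProd [] x),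
      slash_assoc, nil_slash]

theorem isPF_foldl (L : List W) (h : ∀ x ∈ L, AtomicPF x) : IsPF (L.foldl slashProd []) := by
  induction L using List.reverseRecOn with
  | nil => exact isPF_nil
  | append_singleton t x ih =>
    rw [List.foldl_append]
    exact isPF_slash _ _ (ih fun y hy => h y (by simp [hy])) (h x (by simp)).1

theorem exists_fact (n : ℕ) : ∀ a : W, a.length ≤ n → IsPF a → a ≠ [] →
    ∃ L : List W, (∀ x ∈ L, AtomicPF x) ∧ L.foldl slashProd [] = a := by
  induction n with
  | zero =>
    intro a h _ hne
    exact absurd (List.length_eq_zero_iff.1 (by omega)) hne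
  | succ n ih =>
    intro a h ha hne
    by_cases hat : AtomicPF a
    · exact ⟨[a], by simpa using hat, by simp [nil_slash]⟩
    · have : ∃ b c : W, IsPF b ∧ IsPF c ∧ b ≠ [] ∧ c ≠ [] ∧ a = slashProd b c := by
        by_contra hc
        exact hat ⟨ha, hne, hc⟩
      obtain ⟨b, c, hb, hc, hb0, hc0, rfl⟩ := this
      rw [length_slash] at h
      have h1 := List.length_pos_iff.2 hb0
      have h2 := List.length_pos_iff.2 hc0
      obtain ⟨L1, hL1, e1⟩ := ih b (by omega) hb hb0
      obtain ⟨L2, hL2, e2⟩ := ih c (by omega) hc hc0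
      refine ⟨L1 ++ L2, ?_, ?_⟩
      · intro x hx
        rcases List.mem_append.1 hx with hx | hx
        · exact hL1 x hx
        · exact hL2 x hx
      · rw [List.foldl_append, e1, foldl_slash, e2]

theorem shiftW_inj (m : ℕ) (x y : W) (h : shiftW m x = shiftW m y) : x = y := by
  unfold shiftW at h
  exact List.map_injective_iff.2 (fun a b hab => by simpa using hab) h

theorem last_le (P P' x x' : W) (hP : IsPF P) (hP' : IsPF P') (hx : AtomicPF x)
    (hx' : AtomicPF x') (h : slashProd P x = slashProd P' x') : P'.length ≤ P.length := by
  by_contra hlt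
  push Not at hlt
  have hlen : P.length + x.length = P'.length + x'.length := by
    rw [← length_slash, ← length_slash, h]
  obtain ⟨y, v, rfl, hy⟩ : ∃ y v : W, x = y ++ v ∧ y.length = x'.length :=
    ⟨x.take x'.length, x.drop x'.length, by simp, by simp; omega⟩
  have hv : v.length = P'.length - P.length := by
    simp at hlen
    omega
  have h' : shiftW P.length y ++ (shiftW P.length v ++ P) = shiftW P'.length x' ++ P' := by
    simpa [slashProd, shiftW] using h
  obtain ⟨e1, e2⟩ := List.append_inj h' (by simp [length_shiftW, hy])
  have hvpf : IsPF v := by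
    apply isPF_of_slash P v hP
    · intro z hz
      exact hx.1.1 z (by simp [hz])
    · unfold slashProd
      rw [e2]
      exact hP'
  have hyx : y = shiftW v.length x' := by
    apply shiftW_inj P.length
    rw [e1, hv]
    unfold shiftW
    rw [List.map_map]
    apply List.map_congr_left
    intro z _
    simp only [Function.comp]
    omega
  apply hx.2.2
  refine ⟨v, x', hvpf, hx'.1, ?_, hx'.2.1, ?_⟩
  · intro h0
    rw [h0] at hv
    simp at hv
    omega
  · rw [hyx]
    rfl

theorem slash_ne_nil (P x : W) (hx : x ≠ []) : slashProd P x ≠ [] := by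
  simp [slashProd, shiftW, hx]

theorem uniq_fact (L : List W) : ∀ L' : List W, (∀ x ∈ L, AtomicPF x) →
    (∀ x ∈ L', AtomicPF x) → L.foldl slashProd [] = L'.foldl slashProd [] → L = L' := by
  induction L using List.reverseRecOn with
  | nil =>
    intro L' _ hL' h
    rcases List.eq_nil_or_concat' L' with rfl | ⟨t, x, rfl⟩
    · rfl
    · rw [List.foldl_append] at h
      exact absurd h.symm (slash_ne_nil _ _ (hL' x (by simp)).2.1)
  | append_singleton t x ih =>
    intro L' hL hL' h
    rcases List.eq_nil_or_concat' L' with rfl | ⟨t', x', rfl⟩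
    · rw [List.foldl_append] at h
      exact absurd h (slash_ne_nil _ _ (hL x (by simp)).2.1)
    · rw [List.foldl_append, List.foldl_append] at h
      simp only [List.foldl_cons, List.foldl_nil] at h
      have ht : ∀ y ∈ t, AtomicPF y := fun y hy => hL y (by simp [hy])
      have ht' : ∀ y ∈ t', AtomicPF y := fun y hy => hL' y (by simp [hy])
      have hx := hL x (by simp)
      have hx' := hL' x' (by simp)
      have l1 := last_le _ _ _ _ (isPF_foldl t ht) (isPF_foldl t' ht') hx hx' h
      have l2 := last_le _ _ _ _ (isPF_foldl t' ht') (isPF_foldl t ht) hx' hx h.symm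
      have l := le_antisymm l2 l1
      have h2 : shiftW (t.foldl slashProd []).length x ++ t.foldl slashProd [] =
          shiftW (t'.foldl slashProd []).length x' ++ t'.foldl slashProd [] := h
      obtain ⟨e1, e2⟩ := List.append_inj' h2 l
      rw [← l] at e1
      rw [ih t' ht ht' e2, shiftW_inj _ _ _ e1]

/-- Every nonempty parking function factors uniquely as a
slash product of atomic parking functions. -/
theorem stmt11 (a : W) (ha : IsPF a) (hne : a ≠ []) :
    ∃! L : List W, (∀ x ∈ L, AtomicPF x) ∧ L.foldl slashProd [] = a := by
  obtain ⟨L, hL, e⟩ := exists_fact a.length a le_rfl ha hne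
  refine ⟨L, ⟨hL, e⟩, ?_⟩
  rintro L' ⟨hL', e'⟩
  exact uniq_fact L' L hL' hL (e'.trans e.symm)
end
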